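/- For all natural numbers n, r, s, t, u such that n is even, the numbers r, s, u all have the same parity, n ≤ r + u, and n ≤ 2*t + r + s, one has n*(n-1) ≤ r*(r-1) + s*(s-1) + 2*u*(t + s + r). -/

import Mathlib

/-- Arithmetic core of the discrete filling area conjecture for Möbius bands:
if `n` is even, `r`, `s`, `u` all have the same parity, `n ≤ r + u`, and
`n ≤ 2*t + r + s`, then `n*(n-1) ≤ r*(r-1) + s*(s-1) + 2*u*(t + s + r)`. -/
theorem discrete_FAC_mobius_arith (n r s t u : ℕ)
    (hn : Even n) (hrs : r % 2 = s % 2) (hru : r % 2 = u % 2)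
    (h1 : n ≤ r + u) (h2 : n ≤ 2 * t + r + s) :
    n * (n - 1) ≤ r * (r - 1) + s * (s - 1) + 2 * u * (t + s + r) := by
  rcases le_total n r with h | h
  · calc n * (n - 1) ≤ r * (r - 1) := by gcongr
      _ ≤ r * (r - 1) + s * (s - 1) + 2 * u * (t + s + r) := by omega
  · obtain ⟨d, rfl⟩ := Nat.exists_eq_add_of_le h
    have hdu : d ≤ u := by omega
    have hu : d * (2 * r + d + s) ≤ 2 * u * (t + s + r) := by
      calc d * (2 * r + d + s) ≤ u * (2 * (t + s + r)) := by
            gcongr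
            omega
        _ = 2 * u * (t + s + r) := by ring
    have hr : (r + d) * (r + d - 1) ≤ r * (r - 1) + d * (2 * r + d) := by
      rcases r with _ | r
      · simpa using Nat.mul_le_mul_left d (Nat.sub_le d 1)
      · rw [show r + 1 + d - 1 = r + d by omega, Nat.add_sub_cancel]
        nlinarith
    nlinarith [Nat.zero_le (s * (s - 1)), Nat.zero_le (d * s)]
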